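/- arXiv:1510.04711 — 8 statements merged into one kernel-verified Lean document; each statement's English description precedes it below -/
import Mathlib

section
/- Let p ∈ ℝⁿ with p_k > 0 for all k, let v ∈ ℝⁿ, and let Λ be an m×n real matrix with Λ_{jk} ≥ 0 for all j,k, with Σ_j Λ_{jk} = 1 for every k, and such that every row of Λ contains at least one strictly positive entry. Set q_j = Σ_k Λ_{jk} p_k and u_j = Σ_k Λ_{jk} v_k. Then Σ_j u_j² / q_j ≤ Σ_k v_k² / p_k. -/
/-- A weighted form of the Cauchy–Schwarz inequality: for nonnegative weights `w` and positive `p`,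
`(Σ_k w_k v_k)² / Σ_k w_k p_k ≤ Σ_k w_k v_k²/p_k`. -/
theorem sq_sum_mul_div_sum_mul_le {ι : Type*} (s : Finset ι) {w v p : ι → ℝ}
    (hw : ∀ k ∈ s, 0 ≤ w k) (hp : ∀ k ∈ s, 0 < p k) :
    (∑ k ∈ s, w k * v k) ^ 2 / (∑ k ∈ s, w k * p k) ≤ ∑ k ∈ s, w k * (v k ^ 2 / p k) := by
  have hwp : ∀ k ∈ s, 0 ≤ w k * p k := fun k hk => mul_nonneg (hw k hk) (hp k hk).le
  have hwv : ∀ k ∈ s, 0 ≤ w k * (v k ^ 2 / p k) := fun k hk =>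
    mul_nonneg (hw k hk) (div_nonneg (sq_nonneg _) (hp k hk).le)
  refine div_le_of_le_mul₀ (Finset.sum_nonneg hwp) (Finset.sum_nonneg hwv) ?_
  refine Finset.sum_sq_le_sum_mul_sum_of_sq_le_mul s hwv hwp fun k hk => le_of_eq ?_
  have := (hp k hk).ne'
  field_simp

/-- Data-processing inequality for the extended Rényi relative entropy of order 2:
if `q = Λ p` and `u = Λ v` for a stochastic matrix `Λ` (nonnegative entries, columns
summing to 1, every row having a strictly positive entry) and `p` has positive entries,
then `Σ_j u_j²/q_j ≤ Σ_k v_k²/p_k`. -/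
theorem extended_renyi2_data_processing {n m : ℕ}
    (p v : Fin n → ℝ) (hp : ∀ k, 0 < p k)
    (Λ : Fin m → Fin n → ℝ)
    (hΛ : ∀ j k, 0 ≤ Λ j k)
    (hcol : ∀ k, ∑ j, Λ j k = 1)
    (hrow : ∀ j, ∃ k, 0 < Λ j k) :
    ∑ j, (∑ k, Λ j k * v k) ^ 2 / (∑ k, Λ j k * p k)
      ≤ ∑ k, (v k) ^ 2 / p k := by
  calc ∑ j, (∑ k, Λ j k * v k) ^ 2 / (∑ k, Λ j k * p k)
      ≤ ∑ j, ∑ k, Λ j k * (v k ^ 2 / p k) := Finset.sum_le_sum fun j _ =>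
        sq_sum_mul_div_sum_mul_le Finset.univ (fun k _ => hΛ j k) fun k _ => hp k
    _ = ∑ k, v k ^ 2 / p k := by
        rw [Finset.sum_comm]
        simp only [← Finset.sum_mul, hcol, one_mul]
end

section
/- Let f : ℝ → ℝ be a convex function, let p ∈ ℝⁿ with p_k > 0 for all k, let v ∈ ℝⁿ, and let Λ be an m×n real matrix with Λ_{jk} ≥ 0 for all j,k, with Σ_j Λ_{jk} = 1 for every k, and such that every row of Λ contains at least one strictly positive entry. Set q_j = Σ_k Λ_{jk} p_k and u_j = Σ_k Λ_{jk} v_k. Then Σ_j q_j · f(u_j/q_j) ≤ Σ_k p_k · f(v_k/p_k). -/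
/-- Jensen's inequality for the perspective of a convex function (generalized log-sum
inequality), with weights `w` and positive masses `p`. -/
theorem ConvexOn.sum_mul_map_div_le {ι : Type*} {s : Finset ι} {f : ℝ → ℝ}
    (hf : ConvexOn ℝ Set.univ f) {w p : ι → ℝ} (v : ι → ℝ) (hw : ∀ k ∈ s, 0 ≤ w k)
    (hp : ∀ k ∈ s, 0 < p k) (hpos : 0 < ∑ k ∈ s, w k * p k) :
    (∑ k ∈ s, w k * p k) * f ((∑ k ∈ s, w k * v k) / ∑ k ∈ s, w k * p k)
      ≤ ∑ k ∈ s, w k * (p k * f (v k / p k)) := by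
  have jensen := hf.map_centerMass_le (t := s) (w := fun k => w k * p k)
    (p := fun k => v k / p k) (fun k hk => mul_nonneg (hw k hk) (hp k hk).le) hpos
    (fun _ _ => Set.mem_univ _)
  have hv : ∑ k ∈ s, w k * p k * (v k / p k) = ∑ k ∈ s, w k * v k :=
    Finset.sum_congr rfl fun k hk => by
      have := (hp k hk).ne'
      field_simp
  simp only [Finset.centerMass, smul_eq_mul, Function.comp_apply, hv] at jensen
  rw [inv_mul_eq_div, inv_mul_eq_div, le_div_iff₀' hpos] at jensen
  simpa only [mul_assoc] using jensen

/-- Data-processing inequality for the extended `f`-relative entropy: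
for a convex `f : ℝ → ℝ`, `Σ_j q_j f(u_j/q_j) ≤ Σ_k p_k f(v_k/p_k)` where
`q = Λ p`, `u = Λ v` for a stochastic matrix `Λ`. -/
theorem extended_f_relative_entropy_data_processing {n m : ℕ}
    (f : ℝ → ℝ) (hf : ConvexOn ℝ Set.univ f)
    (p v : Fin n → ℝ) (hp : ∀ k, 0 < p k)
    (Λ : Fin m → Fin n → ℝ)
    (hΛ : ∀ j k, 0 ≤ Λ j k)
    (hcol : ∀ k, ∑ j, Λ j k = 1)
    (hrow : ∀ j, ∃ k, 0 < Λ j k) :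
    ∑ j, (∑ k, Λ j k * p k) * f ((∑ k, Λ j k * v k) / (∑ k, Λ j k * p k))
      ≤ ∑ k, p k * f (v k / p k) := by
  calc
    _ ≤ ∑ j, ∑ k, Λ j k * (p k * f (v k / p k)) := by
      refine Finset.sum_le_sum fun j _ =>
        hf.sum_mul_map_div_le v (fun k _ => hΛ j k) (fun k _ => hp k) ?_
      obtain ⟨k, hk⟩ := hrow j
      exact Finset.sum_pos' (fun i _ => mul_nonneg (hΛ j i) (hp i).le)
        ⟨k, Finset.mem_univ k, mul_pos hk (hp k)⟩
    _ = ∑ k, p k * f (v k / p k) := by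
      rw [Finset.sum_comm]
      simp only [← Finset.sum_mul, hcol, one_mul]
end

section
/- Let d ≥ 1, let Q be a positive definite d×d complex matrix, let A_1, …, A_n be nonzero positive semidefinite d×d complex matrices, and let Λ be an m×n real matrix with Λ_{jk} ≥ 0 for all j,k, with Σ_j Λ_{jk} = 1 for every k, and such that every row of Λ contains at least one strictly positive entry. Set B_j = Σ_k Λ_{jk} A_k. Then for every Hermitian d×d matrix C: Σ_j (tr(B_j C))² / tr(Q B_j) ≤ Σ_k (tr(A_k C))² / tr(Q A_k). -/
open ComplexOrder

open scoped MatrixOrder Matrix.Norms.L2Operator in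
/-- The trace of the product of a positive definite matrix and a nonzero positive semidefinite
matrix is positive. -/
theorem Matrix.PosDef.trace_mul_pos {ι : Type*} [Fintype ι] [DecidableEq ι]
    {Q A : Matrix ι ι ℂ} (hQ : Q.PosDef) (hA : A.PosSemidef) (hA0 : A ≠ 0) :
    0 < (Q * A).trace := by
  obtain ⟨X, rfl⟩ : ∃ X : Matrix ι ι ℂ, A = X.conjTranspose * X :=
    CStarAlgebra.nonneg_iff_eq_star_mul_self.mp hA.nonneg
  have htrace : (Q * (X.conjTranspose * X)).trace =
      ∑ i, star (X.conjTranspose.col i) ⬝ᵥ Q.mulVec (X.conjTranspose.col i) := by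
    rw [← Matrix.mul_assoc, Matrix.trace_mul_comm]
    refine Finset.sum_congr rfl fun i _ => ?_
    simp [Matrix.mul_apply, dotProduct, Matrix.mulVec]
  rw [htrace]
  obtain ⟨i, hi⟩ : ∃ i, X.conjTranspose.col i ≠ 0 := by
    by_contra! h
    refine hA0 ?_
    have hX : X.conjTranspose = 0 := by
      ext a b
      exact congrFun (h b) a
    rw [hX, Matrix.zero_mul]
  exact Finset.sum_pos' (fun i _ => hQ.posSemidef.dotProduct_mulVec_nonneg _)
    ⟨i, Finset.mem_univ i, hQ.dotProduct_mulVec_pos hi⟩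

/-- Weighted Cauchy–Schwarz inequality in Sedrakyan's form. -/
theorem sq_sum_mul_div_sum_mul_le_s2 {κ : Type*} [Fintype κ] (w a q : κ → ℝ)
    (hw : ∀ k, 0 ≤ w k) (hq : ∀ k, 0 < q k) :
    (∑ k, w k * a k) ^ 2 / (∑ k, w k * q k) ≤ ∑ k, w k * (a k ^ 2 / q k) := by
  have hwa (k : κ) : 0 ≤ w k * (a k ^ 2 / q k) :=
    mul_nonneg (hw k) (div_nonneg (sq_nonneg _) (hq k).le)
  have hwq (k : κ) : 0 ≤ w k * q k := mul_nonneg (hw k) (hq k).le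
  refine div_le_of_le_mul₀ (Finset.sum_nonneg fun k _ => hwq k)
    (Finset.sum_nonneg fun k _ => hwa k) ?_
  refine Finset.sum_sq_le_sum_mul_sum_of_sq_le_mul _ (fun k _ => hwa k) (fun k _ => hwq k)
    fun k _ => le_of_eq ?_
  have := (hq k).ne'
  field_simp

/-- Order monotonicity of the superoperator `G_Q`: for a positive definite `Q`,
nonzero positive semidefinite matrices `A_k`, and a stochastic matrix `Λ` with
`B_j = Σ_k Λ_{jk} A_k`, for every Hermitian `C`,
`Σ_j (tr(B_j C))²/tr(Q B_j) ≤ Σ_k (tr(A_k C))²/tr(Q A_k)`. -/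
theorem GQ_order_monotone {d n m : ℕ} (hd : 1 ≤ d)
    (Q : Matrix (Fin d) (Fin d) ℂ) (hQ : Q.PosDef)
    (A : Fin n → Matrix (Fin d) (Fin d) ℂ)
    (hA : ∀ k, (A k).PosSemidef) (hA0 : ∀ k, A k ≠ 0)
    (Λ : Fin m → Fin n → ℝ)
    (hΛ : ∀ j k, 0 ≤ Λ j k)
    (hcol : ∀ k, ∑ j, Λ j k = 1)
    (hrow : ∀ j, ∃ k, 0 < Λ j k)
    (B : Fin m → Matrix (Fin d) (Fin d) ℂ)
    (hB : ∀ j, B j = ∑ k, Λ j k • A k)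
    (C : Matrix (Fin d) (Fin d) ℂ) (hC : C.IsHermitian) :
    ∑ j, ((B j * C).trace.re) ^ 2 / (Q * B j).trace.re
      ≤ ∑ k, ((A k * C).trace.re) ^ 2 / (Q * A k).trace.re := by
  have hq (k : Fin n) : 0 < (Q * A k).trace.re :=
    (Complex.pos_iff.mp (hQ.trace_mul_pos (hA k) (hA0 k))).1
  have hBC (j : Fin m) : (B j * C).trace.re = ∑ k, Λ j k * (A k * C).trace.re := by
    simp [hB, Finset.sum_mul, Matrix.trace_sum]
  have hQB (j : Fin m) : (Q * B j).trace.re = ∑ k, Λ j k * (Q * A k).trace.re := by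
    simp [hB, Finset.mul_sum, Matrix.trace_sum]
  calc ∑ j, ((B j * C).trace.re) ^ 2 / (Q * B j).trace.re
      ≤ ∑ j, ∑ k, Λ j k * (((A k * C).trace.re) ^ 2 / (Q * A k).trace.re) := by
        refine Finset.sum_le_sum fun j _ => ?_
        rw [hBC, hQB]
        exact sq_sum_mul_div_sum_mul_le_s2 _ _ _ (hΛ j) hq
    _ = ∑ k, ((A k * C).trace.re) ^ 2 / (Q * A k).trace.re := by
        rw [Finset.sum_comm]
        simp_rw [← Finset.sum_mul, hcol, one_mul]
end

section
/- Let Q be a positive definite d×d complex matrix and let ρ_1, …, ρ_n be nonzero positive semidefinite d×d complex matrices. Then Σ_a tr(Q ρ_a²)/tr(Q ρ_a) ≤ Σ_a tr(ρ_a), and equality holds if and only if every ρ_a has rank 1. -/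
open ComplexOrder

/-- In an eigenbasis of `A`, the traces of `Q * A` and `Q * (A * A)` are weighted sums of the
eigenvalues of `A` and of their squares, with the same positive weights. -/
theorem Matrix.PosDef.exists_pos_weights_trace_mul {ι : Type*} [Fintype ι] [DecidableEq ι]
    {Q A : Matrix ι ι ℂ} (hQ : Q.PosDef) (hA : A.IsHermitian) :
    ∃ q : ι → ℝ, (∀ i, 0 < q i) ∧ (Q * A).trace.re = ∑ i, q i * hA.eigenvalues i ∧
      (Q * (A * A)).trace.re = ∑ i, q i * hA.eigenvalues i ^ 2 := by
  set U := hA.eigenvectorUnitary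
  set Φ := Unitary.conjStarAlgAut ℂ (Matrix ι ι ℂ) U
  set D : Matrix ι ι ℂ := Matrix.diagonal (RCLike.ofReal ∘ hA.eigenvalues)
  have hAD : A = Φ D := hA.spectral_theorem
  set P : Matrix ι ι ℂ := star (U : Matrix ι ι ℂ) * Q * U
  have hP : P.PosDef :=
    (Matrix.IsUnit.posDef_star_left_conjugate_iff (Unitary.toUnits U).isUnit).2 hQ
  have trace_conj (M : Matrix ι ι ℂ) : (Q * Φ M).trace = (P * M).trace := by
    rw [Unitary.conjStarAlgAut_apply, ← mul_assoc, Matrix.trace_mul_comm]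
    simp only [P, mul_assoc]
  refine ⟨fun i => (P i i).re, fun i => (Complex.pos_iff.1 hP.diag_pos).1, ?_, ?_⟩
  · rw [congrArg (Q * ·) hAD, trace_conj]
    simp [D, Matrix.trace, Matrix.mul_diagonal]
  · rw [congrArg (fun M => Q * (M * M)) hAD, ← map_mul, trace_conj]
    simp [D, Matrix.trace, Matrix.mul_diagonal, pow_two]

section WeightedSums

variable {ι : Type*} [Fintype ι] {q l : ι → ℝ}

theorem sum_mul_pos_of_nonneg_of_ne_zero (hq : ∀ i, 0 < q i) (hl : ∀ i, 0 ≤ l i) (hl0 : l ≠ 0) :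
    0 < ∑ i, q i * l i := by
  obtain ⟨i, hi⟩ := Function.ne_iff.1 hl0
  exact Finset.sum_pos' (fun j _ => mul_nonneg (hq j).le (hl j))
    ⟨i, Finset.mem_univ i, mul_pos (hq i) ((hl i).lt_of_ne' hi)⟩

theorem mul_sq_le_mul_mul_sum (hq : ∀ i, 0 < q i) (hl : ∀ i, 0 ≤ l i) (i : ι) :
    q i * l i ^ 2 ≤ q i * l i * ∑ j, l j := by
  rw [pow_two, ← mul_assoc]
  exact mul_le_mul_of_nonneg_left
    (Finset.single_le_sum (fun j _ => hl j) (Finset.mem_univ i)) (mul_nonneg (hq i).le (hl i))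

theorem sum_mul_sq_div_sum_mul_le (hq : ∀ i, 0 < q i) (hl : ∀ i, 0 ≤ l i) (hl0 : l ≠ 0) :
    (∑ i, q i * l i ^ 2) / ∑ i, q i * l i ≤ ∑ i, l i := by
  rw [div_le_iff₀' (sum_mul_pos_of_nonneg_of_ne_zero hq hl hl0), Finset.sum_mul]
  exact Finset.sum_le_sum fun i _ => mul_sq_le_mul_mul_sum hq hl i

theorem sum_mul_sq_div_sum_mul_eq_iff (hq : ∀ i, 0 < q i) (hl : ∀ i, 0 ≤ l i) (hl0 : l ≠ 0) :
    (∑ i, q i * l i ^ 2) / ∑ i, q i * l i = ∑ i, l i ↔ Fintype.card {i // l i ≠ 0} = 1 := by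
  classical
  rw [div_eq_iff (sum_mul_pos_of_nonneg_of_ne_zero hq hl hl0).ne', mul_comm (∑ i, l i),
    Finset.sum_mul, Finset.sum_eq_sum_iff_of_le fun i _ => mul_sq_le_mul_mul_sum hq hl i,
    Fintype.card_eq_one_iff]
  constructor
  · intro h
    obtain ⟨i, hi⟩ := Function.ne_iff.1 hl0
    refine ⟨⟨i, hi⟩, fun ⟨j, hj⟩ => Subtype.ext ?_⟩
    by_contra hji
    have hsum : l i = ∑ k, l k :=
      mul_left_cancel₀ (mul_ne_zero (hq i).ne' hi) (by linarith [h i (Finset.mem_univ i)])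
    rw [← Finset.add_sum_erase _ _ (Finset.mem_univ i), left_eq_add,
      Finset.sum_eq_zero_iff_of_nonneg fun k _ => hl k] at hsum
    exact hj (hsum j (by simpa using hji))
  · rintro ⟨⟨i, hi⟩, hu⟩ j -
    have hzero (k : ι) (hk : k ≠ i) : l k = 0 := by
      by_contra hlk
      exact hk (congrArg Subtype.val (hu ⟨k, hlk⟩))
    rw [Fintype.sum_eq_single i hzero]
    by_cases hj : j = i
    · subst hj; ring
    · simp [hzero j hj]

end WeightedSums

namespace Matrix.PosSemidef

variable {ι : Type*} [Fintype ι] [DecidableEq ι] {Q A : Matrix ι ι ℂ}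

theorem trace_mul_sq_div_trace_mul_le (hA : A.PosSemidef) (hQ : Q.PosDef) (hA0 : A ≠ 0) :
    (Q * (A * A)).trace.re / (Q * A).trace.re ≤ A.trace.re := by
  obtain ⟨q, hq, h1, h2⟩ := hQ.exists_pos_weights_trace_mul hA.isHermitian
  simpa [h1, h2, hA.isHermitian.trace_eq_sum_eigenvalues] using
    sum_mul_sq_div_sum_mul_le hq hA.eigenvalues_nonneg
      (hA.isHermitian.eigenvalues_eq_zero_iff.not.2 hA0)

theorem trace_mul_sq_div_trace_mul_eq_iff (hA : A.PosSemidef) (hQ : Q.PosDef) (hA0 : A ≠ 0) :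
    (Q * (A * A)).trace.re / (Q * A).trace.re = A.trace.re ↔ A.rank = 1 := by
  obtain ⟨q, hq, h1, h2⟩ := hQ.exists_pos_weights_trace_mul hA.isHermitian
  rw [hA.isHermitian.rank_eq_card_non_zero_eigs,
    ← sum_mul_sq_div_sum_mul_eq_iff hq hA.eigenvalues_nonneg
      (hA.isHermitian.eigenvalues_eq_zero_iff.not.2 hA0),
    h1, h2, hA.isHermitian.trace_eq_sum_eigenvalues]
  simp

end Matrix.PosSemidef

/-- For a positive definite `Q` and nonzero positive semidefinite matrices `ρ_a`,
`Σ_a tr(Q ρ_a²)/tr(Q ρ_a) ≤ Σ_a tr(ρ_a)`, with equality iff every `ρ_a` has rank 1. -/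
theorem trace_RQ_GQ_le_one {d n : ℕ}
    (Q : Matrix (Fin d) (Fin d) ℂ) (hQ : Q.PosDef)
    (ρ : Fin n → Matrix (Fin d) (Fin d) ℂ)
    (hρ : ∀ a, (ρ a).PosSemidef) (hρ0 : ∀ a, ρ a ≠ 0) :
    (∑ a, (Q * (ρ a * ρ a)).trace.re / (Q * ρ a).trace.re ≤ ∑ a, (ρ a).trace.re) ∧
    ((∑ a, (Q * (ρ a * ρ a)).trace.re / (Q * ρ a).trace.re = ∑ a, (ρ a).trace.re)
      ↔ ∀ a, (ρ a).rank = 1) := by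
  have hle (a : Fin n) := (hρ a).trace_mul_sq_div_trace_mul_le hQ (hρ0 a)
  refine ⟨Finset.sum_le_sum fun a _ => hle a, ?_⟩
  rw [Finset.sum_eq_sum_iff_of_le fun a _ => hle a]
  simp only [Finset.mem_univ, forall_const]
  exact forall_congr' fun a => (hρ a).trace_mul_sq_div_trace_mul_eq_iff hQ (hρ0 a)
end

section
/- Let {ρ_{a|x}} and {σ_{b|y}} be two state assemblages for the same matrix ρ_B (all members nonzero positive semidefinite d×d matrices), and suppose {ρ_{a|x}} is a coarse graining of {σ_{b|y}}: for every index x there is an index y(x) and nonnegative numbers p_x(a|b) with Σ_a p_x(a|b) = 1 for all b, such that ρ_{a|x} = Σ_b p_x(a|b) σ_{b|y(x)} for all a. Then τ({ρ_{a|x}}) ≤ τ({σ_{b|y}}) and τ̄({ρ_{a|x}}) ≤ τ̄({σ_{b|y}}). -/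
open ComplexOrder Matrix

/-- Quadratic form of the superoperator `G({ρ_a})`:
`⟨C, G({ρ_a}) C⟩ = Σ_a (tr(ρ_a C))²/tr(ρ_a)`. -/
noncomputable def qG {d n : ℕ} (ρ : Fin n → Matrix (Fin d) (Fin d) ℂ)
    (C : Matrix (Fin d) (Fin d) ℂ) : ℝ :=
  ∑ a, ((ρ a * C).trace.re) ^ 2 / (ρ a).trace.re

/-- The traceless part of a matrix: `X̄ = X − (tr(X)/d)·I`. -/
noncomputable def matBar {d : ℕ} (X : Matrix (Fin d) (Fin d) ℂ) :
    Matrix (Fin d) (Fin d) ℂ :=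
  X - (X.trace / (d : ℂ)) • (1 : Matrix (Fin d) (Fin d) ℂ)

/-- Quadratic form of the superoperator `Ḡ({ρ_a})`:
`⟨C, Ḡ({ρ_a}) C⟩ = Σ_a (tr(ρ̄_a C))²/tr(ρ_a)`. -/
noncomputable def qGbar {d n : ℕ} (ρ : Fin n → Matrix (Fin d) (Fin d) ℂ)
    (C : Matrix (Fin d) (Fin d) ℂ) : ℝ :=
  ∑ a, ((matBar (ρ a) * C).trace.re) ^ 2 / (ρ a).trace.re

/-- Given, for each index `x`, the quadratic form `C ↦ ⟨C, G_x C⟩` of a superoperator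
`G_x` on Hermitian matrices, `tauGen` is the infimum of `Tr(F)` over all self-adjoint
linear endomorphisms `F` of the real inner product space of Hermitian matrices
(inner product `⟨X,Y⟩ = tr(XY)`) satisfying `F ≥ G_x` for every `x`. -/
noncomputable def tauGen {d : ℕ} {ι : Type} (q : ι → Matrix (Fin d) (Fin d) ℂ → ℝ) : ℝ :=
  sInf { t : ℝ |
    ∃ F : selfAdjoint (Matrix (Fin d) (Fin d) ℂ) →ₗ[ℝ] selfAdjoint (Matrix (Fin d) (Fin d) ℂ),
      (∀ X Y : selfAdjoint (Matrix (Fin d) (Fin d) ℂ),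
        ((X : Matrix (Fin d) (Fin d) ℂ) * (F Y : Matrix (Fin d) (Fin d) ℂ)).trace.re
          = ((F X : Matrix (Fin d) (Fin d) ℂ) * (Y : Matrix (Fin d) (Fin d) ℂ)).trace.re) ∧
      (∀ (x : ι) (C : selfAdjoint (Matrix (Fin d) (Fin d) ℂ)),
        q x (C : Matrix (Fin d) (Fin d) ℂ)
          ≤ ((C : Matrix (Fin d) (Fin d) ℂ) * (F C : Matrix (Fin d) (Fin d) ℂ)).trace.re) ∧
      LinearMap.trace ℝ (selfAdjoint (Matrix (Fin d) (Fin d) ℂ)) F = t }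

/-- `τ({ρ_{a|x}}) = inf{Tr(F) : F self-adjoint, F ≥ G({ρ_{a|x}}_a) for all x}`. -/
noncomputable def tau {d m : ℕ} {n : Fin m → ℕ}
    (ρ : ∀ x, Fin (n x) → Matrix (Fin d) (Fin d) ℂ) : ℝ :=
  tauGen (fun x => qG (ρ x))

/-- `τ̄({ρ_{a|x}}) = inf{Tr(F) : F self-adjoint, F ≥ Ḡ({ρ_{a|x}}_a) for all x}`. -/
noncomputable def tauBar {d m : ℕ} {n : Fin m → ℕ}
    (ρ : ∀ x, Fin (n x) → Matrix (Fin d) (Fin d) ℂ) : ℝ :=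
  tauGen (fun x => qGbar (ρ x))
/-- The trace form `⟨X, Y⟩ = tr(XY)` as an inner product on Hermitian matrices. -/
noncomputable abbrev traceInnerCore (d : ℕ) :
    InnerProductSpace.Core ℝ (selfAdjoint (Matrix (Fin d) (Fin d) ℂ)) where
  inner X Y := ((X : Matrix (Fin d) (Fin d) ℂ) * (Y : Matrix (Fin d) (Fin d) ℂ)).trace.re
  conj_inner_symm X Y := by
    simp [Matrix.trace_mul_comm (X : Matrix (Fin d) (Fin d) ℂ)]
  re_inner_nonneg X := by
    have h := (Matrix.posSemidef_conjTranspose_mul_self (X : Matrix (Fin d) (Fin d) ℂ)).trace_nonneg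
    rw [← Matrix.star_eq_conjTranspose, selfAdjoint.mem_iff.mp X.2] at h
    exact (Complex.le_def.mp h).1
  add_left X Y Z := by simp [add_mul]
  smul_left X Y r := by simp
  definite X h := by
    have h0 := (Matrix.posSemidef_conjTranspose_mul_self (X : Matrix (Fin d) (Fin d) ℂ)).trace_nonneg
    have h1 := Matrix.trace_conjTranspose_mul_self_eq_zero_iff
      (A := (X : Matrix (Fin d) (Fin d) ℂ))
    rw [← Matrix.star_eq_conjTranspose, selfAdjoint.mem_iff.mp X.2] at h0 h1
    exact Subtype.ext (h1.mp (Complex.ext h (Complex.le_def.mp h0).2.symm))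

/-- A superoperator with nonnegative quadratic form has nonnegative trace. -/
theorem trace_nonneg_of_traceForm_nonneg {d : ℕ}
    (F : selfAdjoint (Matrix (Fin d) (Fin d) ℂ) →ₗ[ℝ] selfAdjoint (Matrix (Fin d) (Fin d) ℂ))
    (hF : ∀ C : selfAdjoint (Matrix (Fin d) (Fin d) ℂ),
      0 ≤ ((C : Matrix (Fin d) (Fin d) ℂ) * (F C : Matrix (Fin d) (Fin d) ℂ)).trace.re) :
    0 ≤ LinearMap.trace ℝ (selfAdjoint (Matrix (Fin d) (Fin d) ℂ)) F := by
  let _ : NormedAddCommGroup (selfAdjoint (Matrix (Fin d) (Fin d) ℂ)) :=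
    (traceInnerCore d).toNormedAddCommGroup
  let _ : InnerProductSpace ℝ (selfAdjoint (Matrix (Fin d) (Fin d) ℂ)) :=
    InnerProductSpace.ofCore (traceInnerCore d).toCore
  have : Module.Finite ℝ (selfAdjoint (Matrix (Fin d) (Fin d) ℂ)) :=
    inferInstanceAs (Module.Finite ℝ (selfAdjoint.submodule ℝ (Matrix (Fin d) (Fin d) ℂ)))
  rw [LinearMap.trace_eq_sum_inner F (stdOrthonormalBasis ℝ _)]
  exact Finset.sum_nonneg fun i _ => hF _

theorem tauGen_nonneg {d : ℕ} {ι : Type} [Nonempty ι] {q : ι → Matrix (Fin d) (Fin d) ℂ → ℝ}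
    (hq : ∀ x C, 0 ≤ q x C) : 0 ≤ tauGen q := by
  apply Real.sInf_nonneg
  rintro t ⟨F, -, hF, rfl⟩
  exact trace_nonneg_of_traceForm_nonneg F fun C =>
    (hq (Classical.arbitrary ι) C).trans (hF _ C)

/-- With no constraint the trace is unbounded below, so the real infimum is `0`. -/
theorem tauGen_of_isEmpty {d : ℕ} (hd : 1 ≤ d) {ι : Type} [IsEmpty ι]
    (q : ι → Matrix (Fin d) (Fin d) ℂ → ℝ) : tauGen q = 0 := by
  apply Real.sInf_of_not_bddBelow
  rintro ⟨B, hB⟩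
  have : Module.Finite ℝ (selfAdjoint (Matrix (Fin d) (Fin d) ℂ)) :=
    inferInstanceAs (Module.Finite ℝ (selfAdjoint.submodule ℝ (Matrix (Fin d) (Fin d) ℂ)))
  have : NeZero d := ⟨by omega⟩
  have : Nontrivial (selfAdjoint (Matrix (Fin d) (Fin d) ℂ)) :=
    ⟨0, 1, fun h => zero_ne_one (congrArg Subtype.val h)⟩
  have hpos : (0 : ℝ) < Module.finrank ℝ (selfAdjoint (Matrix (Fin d) (Fin d) ℂ)) :=
    Nat.cast_pos.mpr Module.finrank_pos
  set n : ℝ := (Module.finrank ℝ (selfAdjoint (Matrix (Fin d) (Fin d) ℂ)) : ℝ) with hn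
  have h := hB ⟨((B - 1) / n) • LinearMap.id, fun X Y => by simp, fun x => isEmptyElim x, rfl⟩
  rw [map_smul, LinearMap.trace_id, ← hn, smul_eq_mul, div_mul_cancel₀ _ hpos.ne'] at h
  linarith

/-- Every finite collection of weighted sums of squares `Σ_a tr(A_a C)²/t_a` is dominated by a
self-adjoint superoperator. -/
theorem exists_dominating_superoperator {d m : ℕ} {n : Fin m → ℕ}
    (A : ∀ y, Fin (n y) → selfAdjoint (Matrix (Fin d) (Fin d) ℂ))
    (t : ∀ y, Fin (n y) → ℝ) (ht : ∀ y b, 0 ≤ t y b) :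
    ∃ F : selfAdjoint (Matrix (Fin d) (Fin d) ℂ) →ₗ[ℝ] selfAdjoint (Matrix (Fin d) (Fin d) ℂ),
      (∀ X Y : selfAdjoint (Matrix (Fin d) (Fin d) ℂ),
        ((X : Matrix (Fin d) (Fin d) ℂ) * (F Y : Matrix (Fin d) (Fin d) ℂ)).trace.re
          = ((F X : Matrix (Fin d) (Fin d) ℂ) * (Y : Matrix (Fin d) (Fin d) ℂ)).trace.re) ∧
      ∀ y (C : selfAdjoint (Matrix (Fin d) (Fin d) ℂ)),
        ∑ b, (((A y b : Matrix (Fin d) (Fin d) ℂ) * (C : Matrix (Fin d) (Fin d) ℂ)).trace.re) ^ 2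
            / t y b
          ≤ ((C : Matrix (Fin d) (Fin d) ℂ) * (F C : Matrix (Fin d) (Fin d) ℂ)).trace.re := by
  let L (B : selfAdjoint (Matrix (Fin d) (Fin d) ℂ)) :
      selfAdjoint (Matrix (Fin d) (Fin d) ℂ) →ₗ[ℝ] ℝ :=
    { toFun := fun C =>
        ((B : Matrix (Fin d) (Fin d) ℂ) * (C : Matrix (Fin d) (Fin d) ℂ)).trace.re
      map_add' := fun X Y => by simp [mul_add]
      map_smul' := fun r X => by simp }
  have hL (B C) : L B C = L C B := by
    simp [L, Matrix.trace_mul_comm (B : Matrix (Fin d) (Fin d) ℂ)]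
  let F : selfAdjoint (Matrix (Fin d) (Fin d) ℂ) →ₗ[ℝ] selfAdjoint (Matrix (Fin d) (Fin d) ℂ) :=
    ∑ y, ∑ b, (t y b)⁻¹ • (L (A y b)).smulRight (A y b)
  have hF (X Y) : L X (F Y) = ∑ y, ∑ b, (t y b)⁻¹ * (L (A y b) Y * L (A y b) X) := by
    simp only [F, LinearMap.sum_apply, map_sum, LinearMap.smul_apply, LinearMap.smulRight_apply,
      map_smul, smul_eq_mul, hL X (A _ _)]
  refine ⟨F, fun X Y => ?_, fun y C => ?_⟩
  · change L X (F Y) = L (F X) Y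
    rw [hL (F X), hF, hF]
    simp only [mul_comm (L _ X)]
  · change ∑ b, (L (A y b) C) ^ 2 / t y b ≤ L C (F C)
    rw [hF]
    refine le_trans (le_of_eq ?_) (Finset.single_le_sum
      (f := fun y => ∑ b, (t y b)⁻¹ * (L (A y b) C * L (A y b) C))
      (fun y _ => Finset.sum_nonneg fun b _ =>
        mul_nonneg (inv_nonneg.mpr (ht y b)) (mul_self_nonneg _)) (Finset.mem_univ y))
    exact Finset.sum_congr rfl fun b _ => by ring

theorem tauGen_mono {d : ℕ} (hd : 1 ≤ d) {ι κ : Type}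
    {q : ι → Matrix (Fin d) (Fin d) ℂ → ℝ} {r : κ → Matrix (Fin d) (Fin d) ℂ → ℝ}
    (hq : ∀ x C, 0 ≤ q x C) (hr : ∀ y C, 0 ≤ r y C)
    (hqr : ∀ x, ∃ y, ∀ C, q x C ≤ r y C)
    (hfeas : ∃ F : selfAdjoint (Matrix (Fin d) (Fin d) ℂ) →ₗ[ℝ]
        selfAdjoint (Matrix (Fin d) (Fin d) ℂ),
      (∀ X Y : selfAdjoint (Matrix (Fin d) (Fin d) ℂ),
        ((X : Matrix (Fin d) (Fin d) ℂ) * (F Y : Matrix (Fin d) (Fin d) ℂ)).trace.re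
          = ((F X : Matrix (Fin d) (Fin d) ℂ) * (Y : Matrix (Fin d) (Fin d) ℂ)).trace.re) ∧
      ∀ y (C : selfAdjoint (Matrix (Fin d) (Fin d) ℂ)), r y (C : Matrix (Fin d) (Fin d) ℂ)
          ≤ ((C : Matrix (Fin d) (Fin d) ℂ) * (F C : Matrix (Fin d) (Fin d) ℂ)).trace.re) :
    tauGen q ≤ tauGen r := by
  rcases isEmpty_or_nonempty ι with hι | hι
  · rw [tauGen_of_isEmpty hd]
    rcases isEmpty_or_nonempty κ with hκ | hκ
    · rw [tauGen_of_isEmpty hd]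
    · exact tauGen_nonneg hr
  · apply csInf_le_csInf
    · refine ⟨0, ?_⟩
      rintro t ⟨F, -, hF, rfl⟩
      exact trace_nonneg_of_traceForm_nonneg F fun C =>
        (hq (Classical.arbitrary ι) C).trans (hF _ C)
    · obtain ⟨F, hsymm, hF⟩ := hfeas
      exact ⟨_, F, hsymm, hF, rfl⟩
    · rintro t ⟨F, hsymm, hF, rfl⟩
      refine ⟨F, hsymm, fun x C => ?_, rfl⟩
      obtain ⟨y, hy⟩ := hqr x
      exact (hy C).trans (hF y C)

/-- Data processing for `Σ v²/t` under a stochastic map, by Cauchy–Schwarz. -/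
theorem sum_sq_div_le_of_stochastic {α β : Type*} [Fintype α] [Fintype β]
    {p : α → β → ℝ} (hp : ∀ a b, 0 ≤ p a b) (hp1 : ∀ b, ∑ a, p a b = 1)
    {v t : β → ℝ} (ht : ∀ b, 0 < t b) :
    ∑ a, (∑ b, p a b * v b) ^ 2 / (∑ b, p a b * t b) ≤ ∑ b, v b ^ 2 / t b := by
  have key (a : α) : (∑ b, p a b * v b) ^ 2 / (∑ b, p a b * t b)
      ≤ ∑ b, p a b * (v b ^ 2 / t b) := by
    have h1 (b : β) : 0 ≤ p a b * (v b ^ 2 / t b) :=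
      mul_nonneg (hp a b) (div_nonneg (sq_nonneg _) (ht b).le)
    have h2 (b : β) : 0 ≤ p a b * t b := mul_nonneg (hp a b) (ht b).le
    refine div_le_of_le_mul₀ (Finset.sum_nonneg fun b _ => h2 b)
      (Finset.sum_nonneg fun b _ => h1 b) ?_
    refine Finset.sum_sq_le_sum_mul_sum_of_sq_le_mul _ (fun b _ => h1 b) (fun b _ => h2 b)
      fun b _ => le_of_eq ?_
    have := (ht b).ne'
    field_simp
  calc _ ≤ ∑ a, ∑ b, p a b * (v b ^ 2 / t b) := Finset.sum_le_sum fun a _ => key a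
    _ = ∑ b, v b ^ 2 / t b := by
      rw [Finset.sum_comm]
      simp [← Finset.sum_mul, hp1]

theorem matBar_sum_smul {d : ℕ} {β : Type*} [Fintype β] (p : β → ℝ)
    (σ : β → Matrix (Fin d) (Fin d) ℂ) :
    matBar (∑ b, p b • σ b) = ∑ b, p b • matBar (σ b) := by
  simp [matBar, smul_sub, Finset.sum_sub_distrib, Matrix.trace_sum, Finset.sum_div,
    Finset.sum_smul, mul_div_assoc, mul_smul]

theorem matBar_isHermitian {d : ℕ} {X : Matrix (Fin d) (Fin d) ℂ} (hX : X.IsHermitian) :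
    (matBar X).IsHermitian := by
  have h : star X.trace = X.trace := by rw [← Matrix.trace_conjTranspose, hX.eq]
  refine hX.sub ?_
  simp only [Matrix.IsHermitian, Matrix.conjTranspose_smul, Matrix.conjTranspose_one, star_div₀,
    h, star_natCast]

theorem trace_re_sum_smul_mul {d : ℕ} {β : Type*} [Fintype β] (p : β → ℝ)
    (σ : β → Matrix (Fin d) (Fin d) ℂ) (C : Matrix (Fin d) (Fin d) ℂ) :
    ((∑ b, p b • σ b) * C).trace.re = ∑ b, p b * (σ b * C).trace.re := by
  simp [Finset.sum_mul, Matrix.trace_sum]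

/-- Order monotonicity of `τ` and `τ̄`: if the state assemblage `{ρ_{a|x}}` is a coarse
graining of the state assemblage `{σ_{b|y}}` for the same `ρ_B`, then
`τ({ρ_{a|x}}) ≤ τ({σ_{b|y}})` and `τ̄({ρ_{a|x}}) ≤ τ̄({σ_{b|y}})`. -/
theorem tau_coarse_graining_monotone {d : ℕ} (hd : 1 ≤ d)
    {m₁ m₂ : ℕ} {nρ : Fin m₁ → ℕ} {nσ : Fin m₂ → ℕ}
    (ρ : ∀ x, Fin (nρ x) → Matrix (Fin d) (Fin d) ℂ)
    (σ : ∀ y, Fin (nσ y) → Matrix (Fin d) (Fin d) ℂ)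
    (hρpsd : ∀ x a, (ρ x a).PosSemidef) (hρ0 : ∀ x a, ρ x a ≠ 0)
    (hσpsd : ∀ y b, (σ y b).PosSemidef) (hσ0 : ∀ y b, σ y b ≠ 0)
    (ρB : Matrix (Fin d) (Fin d) ℂ)
    (hρsum : ∀ x, ∑ a, ρ x a = ρB) (hσsum : ∀ y, ∑ b, σ y b = ρB)
    (hcg : ∀ x, ∃ y : Fin m₂, ∃ p : Fin (nρ x) → Fin (nσ y) → ℝ,
      (∀ a b, 0 ≤ p a b) ∧ (∀ b, ∑ a, p a b = 1) ∧
      (∀ a, ρ x a = ∑ b, p a b • σ y b)) :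
    tau ρ ≤ tau σ ∧ tauBar ρ ≤ tauBar σ := by
  have htρ x a : 0 ≤ (ρ x a).trace.re := (Complex.le_def.mp (hρpsd x a).trace_nonneg).1
  have htσ y b : 0 < (σ y b).trace.re := by
    have h := Complex.le_def.mp (hσpsd y b).trace_nonneg
    refine lt_of_le_of_ne h.1 fun h0 => hσ0 y b ?_
    exact (hσpsd y b).trace_eq_zero_iff.mp (Complex.ext h0.symm h.2.symm)
  have htr {n : ℕ} (p : Fin n → ℝ) (τ : Fin n → Matrix (Fin d) (Fin d) ℂ) :
      (∑ b, p b • τ b).trace.re = ∑ b, p b * (τ b).trace.re := by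
    simp [Matrix.trace_sum]
  constructor
  · refine tauGen_mono hd
      (fun x C => Finset.sum_nonneg fun a _ => div_nonneg (sq_nonneg _) (htρ x a))
      (fun y C => Finset.sum_nonneg fun b _ => div_nonneg (sq_nonneg _) (htσ y b).le)
      (fun x => ?_)
      (exists_dominating_superoperator (fun y b => ⟨σ y b, (hσpsd y b).isHermitian⟩) _
        fun y b => (htσ y b).le)
    obtain ⟨y, p, hp, hp1, hρ⟩ := hcg x
    refine ⟨y, fun C => ?_⟩
    simp only [qG, hρ, trace_re_sum_smul_mul, htr]
    exact sum_sq_div_le_of_stochastic hp hp1 (htσ y)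
  · refine tauGen_mono hd
      (fun x C => Finset.sum_nonneg fun a _ => div_nonneg (sq_nonneg _) (htρ x a))
      (fun y C => Finset.sum_nonneg fun b _ => div_nonneg (sq_nonneg _) (htσ y b).le)
      (fun x => ?_)
      (exists_dominating_superoperator
        (fun y b => ⟨matBar (σ y b), matBar_isHermitian (hσpsd y b).isHermitian⟩) _
        fun y b => (htσ y b).le)
    obtain ⟨y, p, hp, hp1, hρ⟩ := hcg x
    refine ⟨y, fun C => ?_⟩
    simp only [qGbar, hρ, matBar_sum_smul, trace_re_sum_smul_mul, htr]
    exact sum_sq_div_le_of_stochastic hp hp1 (htσ y)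
end

section
/- Let {ρ_{a|x}} be a state assemblage for a matrix ρ_B with tr(ρ_B) = 1, and suppose {ρ_{a|x}} is unsteerable: there exist finitely many nonzero positive semidefinite matrices σ_λ with Σ_λ σ_λ = ρ_B and nonnegative numbers p(a|x,λ) with Σ_a p(a|x,λ) = 1 for all x and λ, such that ρ_{a|x} = Σ_λ p(a|x,λ)·σ_λ for all a, x. Then τ({ρ_{a|x}}) ≤ 1 and τ̄({ρ_{a|x}}) ≤ 1 − 1/d. -/
open ComplexOrder Matrix

/-- The trace of the square of a positive semidefinite matrix is at most the square of its
trace, because all principal `2 × 2` minors are nonnegative. -/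
theorem Matrix.PosSemidef.trace_mul_self_le {d : ℕ} {A : Matrix (Fin d) (Fin d) ℂ}
    (hA : A.PosSemidef) : (A * A).trace ≤ A.trace ^ 2 := by
  have h (i j : Fin d) : A i j * A j i ≤ A i i * A j j := by
    have := (hA.submatrix ![i, j]).det_nonneg
    rw [Matrix.det_fin_two] at this
    exact sub_nonneg.mp this
  calc (A * A).trace = ∑ i, ∑ j, A i j * A j i := by
        simp [Matrix.trace, Matrix.mul_apply]
    _ ≤ ∑ i, ∑ j, A i i * A j j := Finset.sum_le_sum fun i _ => Finset.sum_le_sum fun j _ => h i j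
    _ = A.trace ^ 2 := by simp [Matrix.trace, sq, Finset.sum_mul_sum]

theorem Matrix.PosSemidef.trace_im {d : ℕ} {A : Matrix (Fin d) (Fin d) ℂ}
    (hA : A.PosSemidef) : A.trace.im = 0 :=
  (Complex.nonneg_iff.mp hA.trace_nonneg).2.symm

theorem Matrix.PosSemidef.trace_re_pos {d : ℕ} {A : Matrix (Fin d) (Fin d) ℂ}
    (hA : A.PosSemidef) (h0 : A ≠ 0) : 0 < A.trace.re :=
  (Complex.pos_iff.mp (hA.trace_nonneg.lt_of_ne' (mt hA.trace_eq_zero_iff.mp h0))).1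

theorem Matrix.PosSemidef.trace_mul_self_re_le {d : ℕ} {A : Matrix (Fin d) (Fin d) ℂ}
    (hA : A.PosSemidef) : (A * A).trace.re ≤ A.trace.re ^ 2 := by
  have h := (Complex.le_def.mp hA.trace_mul_self_le).1
  simpa [sq, hA.trace_im] using h

/-- The linear form `C ↦ tr(TC)` on Hermitian matrices. -/
noncomputable def traceForm {d : ℕ} (T : Matrix (Fin d) (Fin d) ℂ) :
    selfAdjoint (Matrix (Fin d) (Fin d) ℂ) →ₗ[ℝ] ℝ where
  toFun C := (T * (C : Matrix (Fin d) (Fin d) ℂ)).trace.re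
  map_add' X Y := by simp [mul_add]
  map_smul' r X := by simp

/-- The superoperator `C ↦ Σ_l (tr(T_l C)/t_l) T_l`. -/
noncomputable def frameOp {d L : ℕ} (T : Fin L → selfAdjoint (Matrix (Fin d) (Fin d) ℂ))
    (t : Fin L → ℝ) :
    selfAdjoint (Matrix (Fin d) (Fin d) ℂ) →ₗ[ℝ] selfAdjoint (Matrix (Fin d) (Fin d) ℂ) :=
  ∑ l, (t l)⁻¹ • (traceForm (T l : Matrix (Fin d) (Fin d) ℂ)).smulRight (T l)

theorem trace_mul_frameOp {d L : ℕ} (T : Fin L → selfAdjoint (Matrix (Fin d) (Fin d) ℂ))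
    (t : Fin L → ℝ) (X Y : selfAdjoint (Matrix (Fin d) (Fin d) ℂ)) :
    ((X : Matrix (Fin d) (Fin d) ℂ) * (frameOp T t Y : Matrix (Fin d) (Fin d) ℂ)).trace.re
      = ∑ l, traceForm (T l) X * traceForm (T l) Y / t l := by
  rw [Matrix.trace_mul_comm]
  change traceForm (frameOp T t Y : Matrix (Fin d) (Fin d) ℂ) X = _
  simp only [traceForm, frameOp, LinearMap.coe_mk, AddHom.coe_mk, LinearMap.sum_apply,
    LinearMap.smul_apply, LinearMap.smulRight_apply, AddSubgroup.val_finsetSum,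
    selfAdjoint.val_smul, Finset.sum_mul, Matrix.trace_sum, Complex.re_sum, smul_mul_assoc,
    Matrix.trace_smul, Complex.real_smul, Complex.re_ofReal_mul]
  exact Finset.sum_congr rfl fun l _ => by ring

instance (d : ℕ) : Module.Finite ℝ (selfAdjoint (Matrix (Fin d) (Fin d) ℂ)) :=
  inferInstanceAs (Module.Finite ℝ (selfAdjoint.submodule ℝ (Matrix (Fin d) (Fin d) ℂ)))

theorem trace_frameOp {d L : ℕ} (T : Fin L → selfAdjoint (Matrix (Fin d) (Fin d) ℂ))
    (t : Fin L → ℝ) :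
    LinearMap.trace ℝ _ (frameOp T t) = ∑ l, traceForm (T l) (T l) / t l := by
  simp [frameOp, div_eq_inv_mul, LinearMap.trace_smulRight]

theorem sum_sq_div_le {n L : ℕ} (p : Fin n → Fin L → ℝ) (hp : ∀ a l, 0 ≤ p a l)
    (hp1 : ∀ l, ∑ a, p a l = 1) (c t : Fin L → ℝ) (ht : ∀ l, 0 < t l) :
    ∑ a, (∑ l, p a l * c l) ^ 2 / ∑ l, p a l * t l ≤ ∑ l, c l * c l / t l := by
  have hnn (a : Fin n) (l : Fin L) : 0 ≤ p a l * (c l * c l / t l) :=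
    mul_nonneg (hp a l) (div_nonneg (mul_self_nonneg _) (ht l).le)
  have hnn' (a : Fin n) (l : Fin L) : 0 ≤ p a l * t l := mul_nonneg (hp a l) (ht l).le
  calc ∑ a, (∑ l, p a l * c l) ^ 2 / ∑ l, p a l * t l
      ≤ ∑ a, ∑ l, p a l * (c l * c l / t l) := by
        refine Finset.sum_le_sum fun a _ => ?_
        refine div_le_of_le_mul₀ (Finset.sum_nonneg fun l _ => hnn' a l)
          (Finset.sum_nonneg fun l _ => hnn a l) ?_
        refine Finset.sum_sq_le_sum_mul_sum_of_sq_le_mul _ (fun l _ => hnn a l)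
          (fun l _ => hnn' a l) fun l _ => le_of_eq ?_
        have := (ht l).ne'
        field_simp
    _ = ∑ l, c l * c l / t l := by
        rw [Finset.sum_comm]
        simp [← Finset.sum_mul, hp1]

/-- No boundedness is needed, since the infimum of a set that is unbounded below is `0`. -/
theorem sInf_le_of_mem_of_nonneg {S : Set ℝ} {s b : ℝ} (hs : s ∈ S) (hsb : s ≤ b)
    (hb : 0 ≤ b) : sInf S ≤ b := by
  by_cases hS : BddBelow S
  · exact (csInf_le hS hs).trans hsb
  · rwa [Real.sInf_of_not_bddBelow hS]

/-- The superoperator of a family `{T_l}` with weights `t_l` dominates all those of families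
obtained from it by stochastic post-processing. -/
theorem tauGen_le_of_postprocessing {d L : ℕ} {ι : Type} {n : ι → ℕ}
    {q : ι → Matrix (Fin d) (Fin d) ℂ → ℝ}
    (T : Fin L → selfAdjoint (Matrix (Fin d) (Fin d) ℂ)) (t : Fin L → ℝ) (ht : ∀ l, 0 < t l)
    (p : ∀ x : ι, Fin (n x) → Fin L → ℝ) (hp : ∀ x a l, 0 ≤ p x a l)
    (hp1 : ∀ x l, ∑ a, p x a l = 1)
    (hq : ∀ (x : ι) (C : selfAdjoint (Matrix (Fin d) (Fin d) ℂ)),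
      q x C = ∑ a, (∑ l, p x a l * traceForm (T l) C) ^ 2 / ∑ l, p x a l * t l)
    {b : ℝ} (hb : 0 ≤ b) (htr : ∑ l, traceForm (T l) (T l) / t l ≤ b) :
    tauGen q ≤ b := by
  refine sInf_le_of_mem_of_nonneg
    ⟨frameOp T t, fun X Y => ?_, fun x C => ?_, trace_frameOp T t⟩ htr hb
  · rw [Matrix.trace_mul_comm (frameOp T t X : Matrix (Fin d) (Fin d) ℂ), trace_mul_frameOp,
      trace_mul_frameOp]
    exact Finset.sum_congr rfl fun l _ => by ring
  · rw [trace_mul_frameOp, hq]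
    exact sum_sq_div_le _ (hp x) (hp1 x) _ t ht

theorem isSelfAdjoint_matBar {d : ℕ} {A : Matrix (Fin d) (Fin d) ℂ} (hA : A.PosSemidef) :
    IsSelfAdjoint (matBar A) := by
  have h : star A.trace = A.trace := by
    simpa [Complex.conj_eq_iff_im] using hA.trace_im
  have h' : star (A.trace / (d : ℂ)) = A.trace / d := by simpa using congrArg (· / (d : ℂ)) h
  exact hA.isHermitian.isSelfAdjoint.sub (.smul h' (.one _))

theorem matBar_sum_smul_s7 {d L : ℕ} (c : Fin L → ℝ) (A : Fin L → Matrix (Fin d) (Fin d) ℂ) :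
    matBar (∑ l, c l • A l) = ∑ l, c l • matBar (A l) := by
  simp only [matBar, smul_sub, Finset.sum_sub_distrib, Matrix.trace_sum, Matrix.trace_smul,
    Finset.sum_div, Finset.sum_smul, smul_div_assoc, smul_assoc]

theorem trace_matBar_mul_self_re_le {d : ℕ} (hd : 1 ≤ d) {A : Matrix (Fin d) (Fin d) ℂ}
    (hA : A.PosSemidef) :
    (matBar A * matBar A).trace.re ≤ A.trace.re ^ 2 * (1 - 1 / d) := by
  have hd' : (d : ℂ) ≠ 0 := by exact_mod_cast (by omega : d ≠ 0)
  have h : (matBar A * matBar A).trace = (A * A).trace - A.trace ^ 2 / d := by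
    simp only [matBar, sub_mul, mul_sub, Matrix.smul_mul, Matrix.mul_smul, one_mul, mul_one,
      Matrix.trace_sub, Matrix.trace_smul, Matrix.trace_one, Fintype.card_fin, smul_eq_mul]
    field_simp
    ring
  have h2 : (A.trace ^ 2 / (d : ℂ)).re = A.trace.re ^ 2 / d := by
    simp [Complex.div_natCast_re, sq, hA.trace_im]
  rw [h, Complex.sub_re, h2]
  linarith [hA.trace_mul_self_re_le, mul_one_div (A.trace.re ^ 2) (d : ℝ)]

/-- Universal steering inequality: any unsteerable state assemblage `{ρ_{a|x}}` for a
state `ρ_B` (with `tr(ρ_B) = 1`) satisfies `τ({ρ_{a|x}}) ≤ 1` and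
`τ̄({ρ_{a|x}}) ≤ 1 − 1/d`. -/
theorem tau_le_of_unsteerable {d m : ℕ} (hd : 1 ≤ d) {n : Fin m → ℕ}
    (ρ : ∀ x : Fin m, Fin (n x) → Matrix (Fin d) (Fin d) ℂ)
    (hpsd : ∀ x a, (ρ x a).PosSemidef) (h0 : ∀ x a, ρ x a ≠ 0)
    (ρB : Matrix (Fin d) (Fin d) ℂ)
    (hsum : ∀ x, ∑ a, ρ x a = ρB) (htr : ρB.trace = 1)
    (hunst : ∃ (L : ℕ) (σ : Fin L → Matrix (Fin d) (Fin d) ℂ)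
        (p : ∀ x : Fin m, Fin (n x) → Fin L → ℝ),
      (∀ l, (σ l).PosSemidef) ∧ (∀ l, σ l ≠ 0) ∧ (∑ l, σ l = ρB) ∧
      (∀ x a l, 0 ≤ p x a l) ∧ (∀ x l, ∑ a, p x a l = 1) ∧
      (∀ x a, ρ x a = ∑ l, p x a l • σ l)) :
    tau ρ ≤ 1 ∧ tauBar ρ ≤ 1 - 1 / d := by
  obtain ⟨L, σ, p, hσ, hσ0, hσB, hp, hp1, hρ⟩ := hunst
  have ht (l : Fin L) : 0 < (σ l).trace.re := (hσ l).trace_re_pos (hσ0 l)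
  have ht1 : ∑ l, (σ l).trace.re = 1 := by
    rw [← Complex.re_sum, ← Matrix.trace_sum, hσB, htr, Complex.one_re]
  have hρt (x : Fin m) (a : Fin (n x)) :
      (ρ x a).trace.re = ∑ l, p x a l * (σ l).trace.re := by
    simp [hρ, Matrix.trace_sum]
  have hb : 0 ≤ 1 - 1 / (d : ℝ) := by
    have : (1 : ℝ) ≤ d := by exact_mod_cast hd
    exact sub_nonneg.mpr (div_le_one_of_le₀ this (by positivity))
  constructor
  · refine tauGen_le_of_postprocessing (fun l => ⟨σ l, (hσ l).isHermitian.isSelfAdjoint⟩)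
      (fun l => (σ l).trace.re) ht p hp hp1 (fun x C => ?_) zero_le_one ?_
    · refine Finset.sum_congr rfl fun a _ => ?_
      rw [hρt]
      congr 2
      simp [hρ, Finset.sum_mul, Matrix.trace_sum, traceForm]
    · rw [← ht1]
      refine Finset.sum_le_sum fun l _ => (div_le_iff₀ (ht l)).mpr ?_
      rw [← sq]
      exact (hσ l).trace_mul_self_re_le
  · refine tauGen_le_of_postprocessing (fun l => ⟨matBar (σ l), isSelfAdjoint_matBar (hσ l)⟩)
      (fun l => (σ l).trace.re) ht p hp hp1 (fun x C => ?_) hb ?_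
    · refine Finset.sum_congr rfl fun a _ => ?_
      rw [hρt]
      congr 2
      simp [hρ, matBar_sum_smul_s7, Finset.sum_mul, Matrix.trace_sum, traceForm]
    · rw [← one_mul (1 - 1 / (d : ℝ)), ← ht1, Finset.sum_mul, ht1]
      refine Finset.sum_le_sum fun l _ => (div_le_iff₀ (ht l)).mpr ?_
      rw [mul_right_comm, ← sq]
      exact trace_matBar_mul_self_re_le hd (hσ l)
end

section
/- Let {M_a} be a POVM on ℂ^d (nonzero positive semidefinite d×d matrices with Σ_a M_a = I). Then for every Hermitian d×d matrix C, Σ_a (tr(M_a C))²/tr(M_a) ≤ tr(C²). More generally, if {ρ_a} is a finite family of nonzero positive semidefinite d×d matrices with Σ_a ρ_a = ρ_B, then for every Hermitian d×d matrix C, Σ_a (tr(ρ_a C))²/tr(ρ_a) ≤ tr(C² ρ_B). -/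
open ComplexOrder

namespace Matrix

/-- Cauchy-Schwarz for the form `(X, Y) ↦ tr(X ρ Yᴴ)`, at `X = 1` and `Y = C` Hermitian. -/
theorem PosSemidef.sq_re_trace_mul_div_le {m : Type*} [Fintype m] {ρ C : Matrix m m ℂ}
    (hρ : ρ.PosSemidef) (hC : C.IsHermitian) :
    (ρ * C).trace.re ^ 2 / ρ.trace.re ≤ (C * C * ρ).trace.re := by
  classical
  have variance_nonneg (s : ℝ) :
      0 ≤ (C * C * ρ).trace.re - 2 * s * (ρ * C).trace.re + s ^ 2 * ρ.trace.re := by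
    have h := (Complex.le_def.mp
      (hρ.mul_mul_conjTranspose_same (C - (s : ℂ) • (1 : Matrix m m ℂ))).trace_nonneg).1
    have h₁ : (C * ρ * C).trace = (C * C * ρ).trace := trace_mul_cycle C ρ C
    have h₂ : (C * ρ).trace = (ρ * C).trace := trace_mul_comm C ρ
    simp [sub_mul, mul_sub, hC.eq, h₁, h₂] at h
    linarith
  have h := variance_nonneg ((ρ * C).trace.re / ρ.trace.re)
  rcases eq_or_ne ρ.trace.re 0 with ht | ht
  · simpa [ht] using h
  · have hs : ((ρ * C).trace.re / ρ.trace.re) ^ 2 * ρ.trace.re =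
        (ρ * C).trace.re ^ 2 / ρ.trace.re := by field_simp
    have hx : 2 * ((ρ * C).trace.re / ρ.trace.re) * (ρ * C).trace.re =
        2 * ((ρ * C).trace.re ^ 2 / ρ.trace.re) := by ring
    linarith

end Matrix

/-- SLD-type bound: for a POVM `{M_a}`, `Σ_a (tr(M_a C))²/tr(M_a) ≤ tr(C²)` for every
Hermitian `C`; more generally, for an ensemble `{ρ_a}` with `Σ_a ρ_a = ρ_B`,
`Σ_a (tr(ρ_a C))²/tr(ρ_a) ≤ tr(C² ρ_B)`. -/
theorem G_le_R_rhoB {d n : ℕ}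
    (ρ : Fin n → Matrix (Fin d) (Fin d) ℂ)
    (hρ : ∀ a, (ρ a).PosSemidef) (hρ0 : ∀ a, ρ a ≠ 0)
    (ρB : Matrix (Fin d) (Fin d) ℂ) (hsum : ∑ a, ρ a = ρB) :
    (∀ C : Matrix (Fin d) (Fin d) ℂ, C.IsHermitian →
      ∑ a, ((ρ a * C).trace.re) ^ 2 / (ρ a).trace.re ≤ (C * C * ρB).trace.re) ∧
    (ρB = 1 → ∀ C : Matrix (Fin d) (Fin d) ℂ, C.IsHermitian →
      ∑ a, ((ρ a * C).trace.re) ^ 2 / (ρ a).trace.re ≤ (C * C).trace.re) := by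
  have key (C : Matrix (Fin d) (Fin d) ℂ) (hC : C.IsHermitian) :
      ∑ a, ((ρ a * C).trace.re) ^ 2 / (ρ a).trace.re ≤ (C * C * ρB).trace.re := by
    rw [← hsum, Finset.mul_sum, Matrix.trace_sum, Complex.re_sum]
    exact Finset.sum_le_sum fun a _ => (hρ a).sq_re_trace_mul_div_le hC
  refine ⟨key, fun h C hC => ?_⟩
  simpa [h] using key C hC
end

section
/- Let Θ ⊆ ℝ be open and let p_k : Θ → ℝ, k = 1, …, n, be differentiable functions with p_k(θ) > 0 for all θ ∈ Θ. Let Λ be an m×n real matrix, independent of θ, with Λ_{jk} ≥ 0 for all j,k, with Σ_j Λ_{jk} = 1 for every k, and such that every row of Λ contains at least one strictly positive entry. Define q_j(θ) = Σ_k Λ_{jk} p_k(θ). Then for every θ ∈ Θ: Σ_j (∂_θ q_j(θ))²/q_j(θ) ≤ Σ_k (∂_θ p_k(θ))²/p_k(θ). -/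
/-- Data-processing inequality for Fisher information: if `q_j(θ) = Σ_k Λ_{jk} p_k(θ)`
for a θ-independent stochastic matrix `Λ`, then
`Σ_j (∂_θ q_j)²/q_j ≤ Σ_k (∂_θ p_k)²/p_k` on `Θ`. -/
theorem fisher_information_data_processing {n m : ℕ}
    (Θ : Set ℝ) (hΘ : IsOpen Θ)
    (p : Fin n → ℝ → ℝ)
    (hdiff : ∀ k, ∀ θ ∈ Θ, DifferentiableAt ℝ (p k) θ)
    (hpos : ∀ k, ∀ θ ∈ Θ, 0 < p k θ)
    (Λ : Fin m → Fin n → ℝ)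
    (hΛ : ∀ j k, 0 ≤ Λ j k)
    (hcol : ∀ k, ∑ j, Λ j k = 1)
    (hrow : ∀ j, ∃ k, 0 < Λ j k)
    (θ : ℝ) (hθ : θ ∈ Θ) :
    ∑ j, (deriv (fun t => ∑ k, Λ j k * p k t) θ) ^ 2 / (∑ k, Λ j k * p k θ)
      ≤ ∑ k, (deriv (p k) θ) ^ 2 / p k θ := by
  have hderiv (j : Fin m) :
      deriv (fun t => ∑ k, Λ j k * p k t) θ = ∑ k, Λ j k * deriv (p k) θ :=
    (HasDerivAt.fun_sum fun k _ => (hdiff k θ hθ).hasDerivAt.const_mul (Λ j k)).deriv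
  have hrow_le (j : Fin m) :
      (∑ k, Λ j k * deriv (p k) θ) ^ 2 / (∑ k, Λ j k * p k θ)
        ≤ ∑ k, Λ j k * ((deriv (p k) θ) ^ 2 / p k θ) := by
    obtain ⟨k₀, hk₀⟩ := hrow j
    have hq : 0 < ∑ k, Λ j k * p k θ :=
      Finset.sum_pos' (fun k _ => mul_nonneg (hΛ j k) (hpos k θ hθ).le)
        ⟨k₀, Finset.mem_univ k₀, mul_pos hk₀ (hpos k₀ θ hθ)⟩
    rw [div_le_iff₀ hq]
    refine Finset.sum_sq_le_sum_mul_sum_of_sq_le_mul _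
      (fun k _ => mul_nonneg (hΛ j k) (div_nonneg (sq_nonneg _) (hpos k θ hθ).le))
      (fun k _ => mul_nonneg (hΛ j k) (hpos k θ hθ).le) fun k _ => Eq.le ?_
    have hp := (hpos k θ hθ).ne'
    field_simp
  calc ∑ j, (deriv (fun t => ∑ k, Λ j k * p k t) θ) ^ 2 / (∑ k, Λ j k * p k θ)
      ≤ ∑ j, ∑ k, Λ j k * ((deriv (p k) θ) ^ 2 / p k θ) :=
        Finset.sum_le_sum fun j _ => by rw [hderiv j]; exact hrow_le j
    _ = ∑ k, (deriv (p k) θ) ^ 2 / p k θ := by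
        rw [Finset.sum_comm]
        simp_rw [← Finset.sum_mul, hcol, one_mul]
end
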